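/- Let D be a bounded domain bounded by m ≥ 2 pairwise disjoint circles, and let W_1,…,W_{m−1} be the derivatives of the multiple-valued holomorphic completions h_j + i h_j* of the harmonic measures of the first m−1 boundary circles. Then the functions W_1,…,W_{m−1} have no common zero in D. -/

import Mathlib

open Complex Set

/-- `u` is harmonic on `s`: locally the real part of a holomorphic function. -/
def HarmonicOnD (u : ℂ → ℝ) (s : Set ℂ) : Prop :=
  ∀ z ∈ s, ∃ ε > 0, ∃ F : ℂ → ℂ, DifferentiableOn ℂ F (Metric.ball z ε) ∧
    ∀ w ∈ Metric.ball z ε, u w = (F w).re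

/-- `Φ` (defined on `bD = frontier D`) extends holomorphically through `D`. -/
def ExtendsHolo (D : Set ℂ) (Φ : ℂ → ℂ) : Prop :=
  ∃ F : ℂ → ℂ, ContinuousOn F (closure D) ∧ DifferentiableOn ℂ F D ∧
    Set.EqOn F Φ (frontier D)

/-- The conjugate of `u` is single valued on `D`: `u` is the real part of a
single-valued holomorphic function on `D`. -/
def HasSingleValuedConjugate (u : ℂ → ℝ) (D : Set ℂ) : Prop :=
  ∃ F : ℂ → ℂ, DifferentiableOn ℂ F D ∧ ∀ z ∈ D, u z = (F z).re

/-- `∫_{bD} φ (∂u/∂n) ds` for a domain bounded by the circles with centers `c j`,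
radii `r j`, the circle `jout` bounding the unbounded complementary component:
the outward unit normal on the circle `j` at `c j + r j e^{iθ}` is `e^{iθ}` if
`j = jout` and `-e^{iθ}` otherwise, and `ds = r j dθ`. -/
noncomputable def bdNormalInt (m : ℕ) (c : Fin m → ℂ) (r : Fin m → ℝ) (jout : Fin m)
    (φ : ℂ → ℝ) (u : ℂ → ℝ) : ℝ :=
  ∑ j, (if j = jout then (1:ℝ) else -1) *
    ∫ θ in (0:ℝ)..2 * Real.pi,
      φ (c j + r j * Complex.exp (θ * Complex.I)) *
        fderiv ℝ u (c j + r j * Complex.exp (θ * Complex.I))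
          (Complex.exp (θ * Complex.I)) * r j

/-- `∫_{bD} f(ζ) dζ` with the standard boundary orientation: the outer circle
`jout` counterclockwise, the inner circles clockwise. -/
noncomputable def bdContour (m : ℕ) (c : Fin m → ℂ) (r : Fin m → ℝ) (jout : Fin m)
    (f : ℂ → ℂ) : ℂ :=
  ∑ j, (if j = jout then (1:ℂ) else -1) * circleIntegral f (c j) (r j)

/-- `W = (h + i h*)' = ∂h/∂x - i ∂h/∂y`, the (single-valued) derivative of the
multiple-valued holomorphic completion of a harmonic function `h`. -/
noncomputable def Wfun (h : ℂ → ℝ) (z : ℂ) : ℂ :=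
  ((fderiv ℝ h z 1 : ℝ) : ℂ) - Complex.I * ((fderiv ℝ h z Complex.I : ℝ) : ℂ)


lemma exp_one_const {S : Set ℝ} (hS : IsPreconnected S) (f : ℝ → ℂ) (hf : ContinuousOn f S)
    (h1 : ∀ t ∈ S, exp (f t) = 1) {a b : ℝ} (ha : a ∈ S) (hb : b ∈ S) : f a = f b := by
  have key : ∀ t ∈ S, ∃ n : ℤ, f t = n * (2 * Real.pi * I) := fun t ht => exp_eq_one_iff.1 (h1 t ht)
  let g : ℝ → ℝ := fun t => (f t).im / (2 * Real.pi)
  have hg : ContinuousOn g S := by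
    apply ContinuousOn.div_const
    exact continuous_im.comp_continuousOn hf
  have hgi : ∀ t ∈ S, ∀ n : ℤ, f t = n * (2 * Real.pi * I) → g t = n := by
    intro t ht n hn
    simp only [g, hn]
    have : ((n : ℂ) * (2 * Real.pi * I)).im = n * (2 * Real.pi) := by simp
    rw [this]
    field_simp
  obtain ⟨n, hn⟩ := key a ha
  obtain ⟨k, hk⟩ := key b hb
  have hoc := (hS.image g hg).ordConnected
  have hga := hgi a ha n hn
  have hgb := hgi b hb k hk
  have aux : ∀ n k : ℤ, (n:ℝ) ∈ g '' S → (k:ℝ) ∈ g '' S → ¬ n < k := by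
    intro n k h1 h2 hlt
    have hlt' : (n:ℝ) + 1 ≤ k := by exact_mod_cast hlt
    have : (n:ℝ) + 1/2 ∈ g '' S := hoc.out h1 h2 ⟨by linarith, by linarith⟩
    obtain ⟨t, ht, hte⟩ := this
    obtain ⟨j, hj⟩ := key t ht
    rw [hgi t ht j hj] at hte
    have h3 : (2 * j : ℤ) = 2 * n + 1 := by
      have : (2 * j : ℝ) = 2 * n + 1 := by linarith
      exact_mod_cast this
    omega
  have e1 : (n:ℝ) ∈ g '' S := ⟨a, ha, hga⟩
  have e2 : (k:ℝ) ∈ g '' S := ⟨b, hb, hgb⟩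
  have : n = k := le_antisymm (not_lt.1 (aux k n e2 e1)) (not_lt.1 (aux n k e1 e2))
  rw [hn, hk, this]

lemma log_neg_exp {δ : ℝ} (h0 : 0 < δ) (h1 : δ < 2 * Real.pi) :
    -exp (δ * I) ∈ slitPlane ∧ log (-exp (δ * I)) = (δ - Real.pi) * I := by
  have e : -exp (δ * I) = exp (((δ - Real.pi : ℝ) : ℂ) * I) := by
    push_cast
    rw [sub_mul, exp_sub, exp_pi_mul_I, div_neg, div_one]
  have hl : log (-exp (δ * I)) = (δ - Real.pi) * I := by
    rw [e, log_exp]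
    · push_cast; ring
    · simp; linarith
    · simp; linarith
  refine ⟨?_, hl⟩
  rw [mem_slitPlane_iff_arg]
  constructor
  · rw [← log_im, hl]; simp; linarith
  · simp

lemma corner {U : Set (ℝ × ℝ)} {L G : ℝ × ℝ → ℂ} (hL : ContinuousOn L U)
    (hLG : EqOn (exp ∘ L) G U) (σ : ℝ → ℝ × ℝ) (hσ : Continuous σ)
    (hσU : ∀ t ∈ Icc (0:ℝ) 1, σ t ∈ U) (A B : ℂ) (hA : A ≠ 0) (hB : B ∈ slitPlane)
    (hG : ∀ t ∈ Icc (0:ℝ) 1, G (σ t) = A * ((1 - t) + t * B)) :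
    L (σ 1) - L (σ 0) = log B := by
  have hsl : ∀ t ∈ Icc (0:ℝ) 1, ((1 - t) + t * B : ℂ) ∈ slitPlane := by
    intro t ht
    have := starConvex_one_slitPlane hB (by linarith [ht.2] : (0:ℝ) ≤ 1 - t) ht.1 (by ring)
    simpa using this
  have := exp_one_const isPreconnected_Icc
    (fun t : ℝ => L (σ t) - L (σ 0) - log ((1 - t) + t * B)) ?_ ?_
    (left_mem_Icc.2 zero_le_one) (right_mem_Icc.2 zero_le_one)
  · simp at this
    rw [← sub_eq_zero, ← this]
  · apply ContinuousOn.sub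
    · exact (hL.comp hσ.continuousOn hσU).sub continuousOn_const
    · apply ContinuousOn.clog
      · fun_prop
      · exact hsl
  · intro t ht
    have z : (0:ℝ) ∈ Icc (0:ℝ) 1 := ⟨le_rfl, zero_le_one⟩
    have e1 : exp (L (σ t)) = _ := (hLG (hσU t ht)).trans (hG t ht)
    have e0 : exp (L (σ 0)) = _ := (hLG (hσU 0 z)).trans (hG 0 z)
    have hne := slitPlane_ne_zero (hsl t ht)
    rw [exp_sub, exp_sub, e1, e0, exp_log hne]
    simp
    field_simp

lemma crossing (p q : ℝ → ℂ) (hp : Continuous p) (hq : Continuous q)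
    (hp0 : ∀ s, s ≤ 0 → p s = 0) (hp3 : ∀ s, 3 ≤ s → p s = 0)
    (hq0 : ∀ s, s ≤ 0 → q s = 0) (hq3 : ∀ s, 3 ≤ s → q s = 0)
    (hpn : ∀ s ∈ Ioo (0:ℝ) 3, p s ≠ 0) (hqn : ∀ s ∈ Ioo (0:ℝ) 3, q s ≠ 0)
    (hpq : ∀ s ∈ Ioo (0:ℝ) 3, ∀ t ∈ Ioo (0:ℝ) 3, p s ≠ q t)
    (ω : ℂ) (hω : ω ≠ 0) (δ : ℝ) (hδ : 0 < δ) (hδ' : 3 * δ < 2 * Real.pi)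
    (hpa : ∀ s ∈ Icc (0:ℝ) 1, p s = s * ω)
    (hpb : ∀ s ∈ Icc (2:ℝ) 3, p s = (3 - s) * (ω * exp (δ * I) ^ 2))
    (hqa : ∀ s ∈ Icc (0:ℝ) 1, q s = s * (ω * exp (δ * I)))
    (hqb : ∀ s ∈ Icc (2:ℝ) 3, q s = (3 - s) * (ω * exp (δ * I) ^ 3)) : False := by
  let U : Set (ℝ × ℝ) := {x | x.1 ∈ Ioo (0:ℝ) 3 ∨ x.2 ∈ Ioo (0:ℝ) 3}
  have hUo : IsOpen U := (isOpen_Ioo.preimage continuous_fst).union (isOpen_Ioo.preimage continuous_snd)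
  let G : ℝ × ℝ → ℂ := fun x => p x.1 - q x.2
  have hstar : StarConvex ℝ ((3/2, 3/2) : ℝ × ℝ) U := by
    rintro ⟨x, y⟩ hxy a b ha hb hab
    have h : (3/2:ℝ) ∈ Ioo (0:ℝ) 3 := by constructor <;> norm_num
    rcases hxy with hx | hy
    · left
      exact (convex_Ioo (0:ℝ) 3) h hx ha hb hab
    · right
      exact (convex_Ioo (0:ℝ) 3) h hy ha hb hab
  have hUs : IsSimplyConnected U := by
    have : ContractibleSpace U := hstar.contractibleSpace ⟨(1,1), Or.inl (by constructor <;> norm_num)⟩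
    have : SimplyConnectedSpace U := inferInstance
    exact this
  have hout : ∀ s : ℝ, s ∉ Ioo (0:ℝ) 3 → s ≤ 0 ∨ 3 ≤ s := by
    intro s hs
    by_contra hc
    push Not at hc
    exact hs hc
  have hG0 : 0 ∉ G '' U := by
    rintro ⟨⟨x, y⟩, hxy, h0⟩
    simp only [G] at h0
    have h0 : p x = q y := sub_eq_zero.1 h0
    by_cases hx : x ∈ Ioo (0:ℝ) 3
    · by_cases hy : y ∈ Ioo (0:ℝ) 3
      · exact hpq x hx y hy h0
      · have : q y = 0 := (hout y hy).elim (hq0 y) (hq3 y)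
        exact hpn x hx (h0.trans this)
    · have hy : y ∈ Ioo (0:ℝ) 3 := hxy.resolve_left hx
      have : p x = 0 := (hout x hx).elim (hp0 x) (hp3 x)
      exact hqn y hy (h0.symm.trans this)
  obtain ⟨L, hL, hLG⟩ := exists_continuousOn_eqOn_exp_comp hUs hUo
    (g := G) (by fun_prop) hG0
  have he : exp (δ * I) ≠ 0 := exp_ne_zero _
  obtain ⟨s1, l1⟩ := log_neg_exp hδ (by linarith)
  obtain ⟨s2, l2⟩ := log_neg_exp (δ := 2 * Real.pi - 3 * δ) (by linarith) (by linarith)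
  have he3 : exp (((2 * Real.pi - 3 * δ : ℝ) : ℂ) * I) = (exp (δ * I) ^ 3)⁻¹ := by
    rw [← exp_nat_mul, ← exp_neg]
    push_cast
    rw [sub_mul, exp_sub, exp_two_pi_mul_I, one_div, ← exp_neg]
    congr 1; ring
  have c1 := corner hL hLG (fun t => (1 - t, t)) (by fun_prop) (by
      intro t ht
      rcases eq_or_lt_of_le ht.1 with h | h
      · left; rw [← h]; constructor <;> norm_num
      · right; exact ⟨h, by linarith [ht.2]⟩) ω (-exp (δ * I)) hω s1 (by
      intro t ht
      simp only [G]
      rw [hpa _ ⟨by linarith [ht.2], by linarith [ht.1]⟩, hqa t ht]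
      push_cast; ring)
  have c2 := corner hL hLG (fun t => (t, 2 + t)) (by fun_prop) (by
      intro t ht
      rcases eq_or_lt_of_le ht.1 with h | h
      · right; rw [← h]; constructor <;> norm_num
      · left; exact ⟨h, by linarith [ht.2]⟩) (-(ω * exp (δ * I) ^ 3))
        (-exp (((2 * Real.pi - 3 * δ : ℝ) : ℂ) * I)) (by simp [hω]) s2 (by
      intro t ht
      simp only [G]
      rw [hpa t ht, hqb (2 + t) ⟨by linarith [ht.1], by linarith [ht.2]⟩, he3]
      push_cast
      field_simp
      ring)
  have c3 := corner hL hLG (fun t => (2 + t, 3 - t)) (by fun_prop) (by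
      intro t ht
      rcases eq_or_lt_of_le ht.1 with h | h
      · left; rw [← h]; constructor <;> norm_num
      · right; exact ⟨by linarith [ht.2], by linarith⟩) (ω * exp (δ * I) ^ 2)
        (-exp (δ * I)) (by simp [hω]) s1 (by
      intro t ht
      simp only [G]
      rw [hpb (2 + t) ⟨by linarith [ht.1], by linarith [ht.2]⟩,
        hqb (3 - t) ⟨by linarith [ht.2], by linarith [ht.1]⟩]
      push_cast
      ring)
  have c4 := corner hL hLG (fun t => (3 - t, 1 - t)) (by fun_prop) (by
      intro t ht
      rcases eq_or_lt_of_le ht.1 with h | h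
      · right; rw [← h]; constructor <;> norm_num
      · left; exact ⟨by linarith [ht.2], by linarith⟩) (-(ω * exp (δ * I)))
        (-exp (δ * I)) (by simp [hω]) s1 (by
      intro t ht
      simp only [G]
      rw [hpb (3 - t) ⟨by linarith [ht.2], by linarith [ht.1]⟩,
        hqa (1 - t) ⟨by linarith [ht.2], by linarith [ht.1]⟩]
      push_cast
      ring)
  have hi : ∀ t ∈ Icc (1:ℝ) 2, t ∈ Ioo (0:ℝ) 3 := fun t ht =>
    ⟨by linarith [ht.1], by linarith [ht.2]⟩
  have d1 := exp_one_const (isPreconnected_Icc (a := (1:ℝ)) (b := 2))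
    (fun t => L (0, t) - L (3, t)) (by
      apply ContinuousOn.sub
      · exact hL.comp (by fun_prop) (fun t ht => Or.inr (hi t ht))
      · exact hL.comp (by fun_prop) (fun t ht => Or.inr (hi t ht))) (by
      intro t ht
      have e1 : exp (L (0, t)) = _ := hLG (x := (0, t)) (Or.inr (hi t ht))
      have e2 : exp (L (3, t)) = _ := hLG (x := (3, t)) (Or.inr (hi t ht))
      rw [exp_sub, e1, e2]
      simp only [G]
      rw [hp0 0 le_rfl, hp3 3 le_rfl]
      exact div_self (by simpa using hqn t (hi t ht)))
    (a := 1) (b := 2) (by constructor <;> norm_num) (by constructor <;> norm_num)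
  have d2 := exp_one_const (isPreconnected_Icc (a := (1:ℝ)) (b := 2))
    (fun t => L (t, 0) - L (t, 3)) (by
      apply ContinuousOn.sub
      · exact hL.comp (by fun_prop) (fun t ht => Or.inl (hi t ht))
      · exact hL.comp (by fun_prop) (fun t ht => Or.inl (hi t ht))) (by
      intro t ht
      have e1 : exp (L (t, 0)) = _ := hLG (x := (t, 0)) (Or.inl (hi t ht))
      have e2 : exp (L (t, 3)) = _ := hLG (x := (t, 3)) (Or.inl (hi t ht))
      rw [exp_sub, e1, e2]
      simp only [G]
      rw [hq0 0 le_rfl, hq3 3 le_rfl]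
      exact div_self (by simpa using hpn t (hi t ht)))
    (a := 1) (b := 2) (by constructor <;> norm_num) (by constructor <;> norm_num)
  rw [l1] at c1 c3 c4
  rw [l2] at c2
  norm_num at c1 c2 c3 c4 d1 d2
  have : (2 * Real.pi * I : ℂ) = 0 := by
    linear_combination c1 + c2 + c3 + c4 - d1 + d2
  simp [Real.pi_ne_zero] at this

lemma build_path {S : Set ℂ} (hS : IsPathConnected S) (a b : ℂ)
    (ha : ∀ t ∈ Ioc (0:ℝ) 1, (t * a : ℂ) ∈ S) (hb : ∀ t ∈ Ioc (0:ℝ) 1, (t * b : ℂ) ∈ S) :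
    ∃ p : ℝ → ℂ, Continuous p ∧ (∀ s, s ≤ 0 → p s = 0) ∧ (∀ s, 3 ≤ s → p s = 0) ∧
      (∀ s ∈ Ioo (0:ℝ) 3, p s ∈ S) ∧ (∀ s ∈ Icc (0:ℝ) 1, p s = s * a) ∧
      (∀ s ∈ Icc (2:ℝ) 3, p s = (3 - s) * b) := by
  have h1 : (1:ℝ) ∈ Ioc (0:ℝ) 1 := ⟨one_pos, le_rfl⟩
  obtain ⟨γ, hγ⟩ := hS.joinedIn a (by simpa using ha 1 h1) b (by simpa using hb 1 h1)
  let p : ℝ → ℂ := fun s => if s ≤ 1 then (max s 0 : ℝ) * a else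
    if s ≤ 2 then γ.extend (s - 1) else (max (3 - s) 0 : ℝ) * b
  have hγS : ∀ s, γ.extend s ∈ S := by
    intro s
    have : γ.extend s ∈ range γ.extend := mem_range_self s
    rw [Path.extend_range] at this
    obtain ⟨t, ht⟩ := this
    exact ht ▸ hγ t
  refine ⟨p, ?_, ?_, ?_, ?_, ?_, ?_⟩
  · apply Continuous.if_le
    · fun_prop
    · apply Continuous.if_le
      · exact γ.continuous_extend.comp (by fun_prop)
      · fun_prop
      · fun_prop
      · fun_prop
      · intro x hx; subst hx; norm_num
    · fun_prop
    · fun_prop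
    · intro x hx; subst hx; norm_num
  · intro s hs
    simp only [p]
    rw [if_pos (by linarith), max_eq_right hs]; simp
  · intro s hs
    simp only [p]
    rw [if_neg (by linarith), if_neg (by linarith), max_eq_right (by linarith)]; simp
  · intro s hs
    simp only [p]
    split_ifs with h2 h3
    · rw [max_eq_left hs.1.le]; exact ha s ⟨hs.1, h2⟩
    · exact hγS _
    · rw [max_eq_left (by linarith [hs.2])]; exact hb _ ⟨by linarith [hs.2], by linarith⟩
  · intro s hs
    simp only [p]
    rw [if_pos hs.2, max_eq_left hs.1]
  · intro s hs
    simp only [p]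
    rw [if_neg (by linarith [hs.1])]
    split_ifs with h3
    · have : s = 2 := le_antisymm h3 hs.1
      subst this; norm_num
    · rw [max_eq_left (by linarith [hs.2])]; push_cast; ring

lemma no_cross {P N : Set ℂ} (hP : IsPathConnected P) (hN : IsPathConnected N)
    (hPN : Disjoint P N) (hP0 : (0:ℂ) ∉ P) (hN0 : (0:ℂ) ∉ N)
    (ω : ℂ) (hω : ω ≠ 0) (δ : ℝ) (hδ : 0 < δ) (hδ' : 3 * δ < 2 * Real.pi)
    (h0 : ∀ t ∈ Ioc (0:ℝ) 1, (t * ω : ℂ) ∈ P)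
    (h1 : ∀ t ∈ Ioc (0:ℝ) 1, (t * (ω * exp (δ * I)) : ℂ) ∈ N)
    (h2 : ∀ t ∈ Ioc (0:ℝ) 1, (t * (ω * exp (δ * I) ^ 2) : ℂ) ∈ P)
    (h3 : ∀ t ∈ Ioc (0:ℝ) 1, (t * (ω * exp (δ * I) ^ 3) : ℂ) ∈ N) : False := by
  obtain ⟨p, hp, hp0, hp3, hpS, hpa, hpb⟩ := build_path hP _ _ h0 h2
  obtain ⟨q, hq, hq0, hq3, hqS, hqa, hqb⟩ := build_path hN _ _ h1 h3
  refine crossing p q hp hq hp0 hp3 hq0 hq3 ?_ ?_ ?_ ω hω δ hδ hδ' hpa hpb hqa hqb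
  · intro s hs h; exact hP0 (h ▸ hpS s hs)
  · intro s hs h; exact hN0 (h ▸ hqS s hs)
  · intro s hs t ht h; exact hPN.ne_of_mem (hpS s hs) (hqS t ht) h

open Topology Filter in
lemma local_sectors {F : ℂ → ℂ} {z0 : ℂ} (hF : AnalyticAt ℂ F z0) (h0 : (F z0).re = 0)
    (hd : deriv F z0 = 0) (hnc : ¬ ∀ᶠ z in 𝓝 z0, F z = F z0) (O : Set ℂ) (hO : O ∈ 𝓝 z0) :
    ∃ (ω : ℂ) (δ : ℝ), ω ≠ 0 ∧ 0 < δ ∧ 3 * δ < 2 * Real.pi ∧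
      ∀ k : ℕ, k < 4 → ∀ t ∈ Ioc (0:ℝ) 1,
        z0 + t * (ω * exp (δ * I) ^ k) ∈ O ∧
        0 < (-1) ^ k * (F (z0 + t * (ω * exp (δ * I) ^ k))).re := by
  have hF' : AnalyticAt ℂ (fun z => F z - F z0) z0 := hF.sub analyticAt_const
  obtain ⟨n, g, hg, hgne, hfg⟩ := hF'.exists_eventuallyEq_pow_smul_nonzero_iff.2
    (by simpa [sub_eq_zero] using hnc)
  have hn0 : n ≠ 0 := by
    rintro rfl
    have := hfg.self_of_nhds
    simp at this
    exact hgne this.symm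
  have hn1 : n ≠ 1 := by
    rintro rfl
    have h1 : HasDerivAt (fun z => F z - F z0) (0:ℂ) z0 := by
      have := hF.differentiableAt.hasDerivAt
      rw [hd] at this
      simpa using this.sub_const (F z0)
    have h2 : HasDerivAt (fun z => (z - z0) ^ 1 • g z) (g z0) z0 := by
      have := ((hasDerivAt_id z0).sub_const z0).mul hg.differentiableAt.hasDerivAt
      simp only [id_eq, sub_self, zero_mul, add_zero, one_mul] at this
      simp only [pow_one, smul_eq_mul]
      exact this
    have h3 := h2.congr_of_eventuallyEq hfg
    exact hgne (h3.unique h1)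
  have hn : 2 ≤ n := by omega
  have hnpos : (0:ℝ) < n := by positivity
  have hnC : (n:ℂ) ≠ 0 := by exact_mod_cast hn0
  set c := g z0 with hc
  let ω0 : ℂ := exp (-(arg c / n : ℝ) * I)
  let δ : ℝ := Real.pi / n
  have hω0 : ω0 ^ n * c = (‖c‖ : ℂ) := by
    have e1 : ω0 ^ n = exp (-(arg c * I)) := by
      simp only [ω0]
      rw [← exp_nat_mul]
      congr 1
      push_cast
      field_simp
    conv_lhs => rw [e1, ← norm_mul_exp_arg_mul_I c]
    rw [mul_left_comm, ← exp_add]; simp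
  have hδn : exp (δ * I) ^ n = -1 := by
    rw [← exp_nat_mul, ← exp_pi_mul_I]
    congr 1
    simp only [δ]
    push_cast
    field_simp
  have hk : ∀ k : ℕ, ∀ᶠ z in 𝓝 z0, 0 < (-1:ℝ) ^ k * ((ω0 * exp (δ * I) ^ k) ^ n * g z).re := by
    intro k
    have hcont : ContinuousAt
        (fun z => (-1:ℝ) ^ k * ((ω0 * exp (δ * I) ^ k) ^ n * g z).re) z0 := by
      have := hg.continuousAt
      fun_prop
    apply hcont.eventually (lt_mem_nhds _)
    have : (ω0 * exp (δ * I) ^ k) ^ n * g z0 = (((-1:ℝ) ^ k * ‖c‖ : ℝ) : ℂ) := by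
      rw [mul_pow, ← pow_mul, mul_comm k n, pow_mul, hδn]
      push_cast
      rw [← hω0]; ring
    beta_reduce
    rw [this, ofReal_re, ← mul_assoc, ← mul_pow]
    simpa using hgne
  have hall : ∀ᶠ z in 𝓝 z0, (F z - F z0 = (z - z0) ^ n • g z) ∧ z ∈ O ∧
      (0 < (-1:ℝ) ^ 0 * ((ω0 * exp (δ * I) ^ 0) ^ n * g z).re) ∧
      (0 < (-1:ℝ) ^ 1 * ((ω0 * exp (δ * I) ^ 1) ^ n * g z).re) ∧
      (0 < (-1:ℝ) ^ 2 * ((ω0 * exp (δ * I) ^ 2) ^ n * g z).re) ∧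
      (0 < (-1:ℝ) ^ 3 * ((ω0 * exp (δ * I) ^ 3) ^ n * g z).re) := by
    filter_upwards [hfg, hO, hk 0, hk 1, hk 2, hk 3] with z h1 h2 h3 h4 h5 h6
    exact ⟨h1, h2, h3, h4, h5, h6⟩
  obtain ⟨ε, hε, hball⟩ := Metric.eventually_nhds_iff.1 hall
  refine ⟨(ε / 2 : ℝ) * ω0, δ, ?_, ?_, ?_, ?_⟩
  · have : (ε / 2 : ℝ) ≠ 0 := by positivity
    exact mul_ne_zero (by exact_mod_cast this) (exp_ne_zero _)
  · simp only [δ]; positivity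
  · simp only [δ]
    have h2 : (2:ℝ) ≤ n := by exact_mod_cast hn
    rw [← mul_div_assoc, div_lt_iff₀ hnpos]
    nlinarith [Real.pi_pos]
  · intro k hk4 t ht
    set z := z0 + t * ((ε / 2 : ℝ) * ω0 * exp (δ * I) ^ k) with hz
    have hzz : z - z0 = ((t * (ε / 2) : ℝ) : ℂ) * (ω0 * exp (δ * I) ^ k) := by
      rw [hz]; push_cast; ring
    have hnorm : ‖ω0 * exp (δ * I) ^ k‖ = 1 := by
      rw [norm_mul, norm_pow, norm_exp_ofReal_mul_I, one_pow, mul_one]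
      simp only [ω0]
      rw [← ofReal_neg, norm_exp_ofReal_mul_I]
    have hdist : dist z z0 < ε := by
      rw [dist_eq_norm, hzz, norm_mul, hnorm, mul_one, norm_real, Real.norm_eq_abs,
        abs_of_pos (mul_pos ht.1 (by positivity))]
      nlinarith [ht.2]
    obtain ⟨e1, e2, e3, e4, e5, e6⟩ := hball hdist
    refine ⟨e2, ?_⟩
    have hre : (F z).re = (t * (ε / 2)) ^ n * ((ω0 * exp (δ * I) ^ k) ^ n * g z).re := by
      have : (F z).re = (F z - F z0).re := by simp [h0]
      rw [this, e1, hzz, mul_pow, smul_eq_mul, mul_assoc, ← ofReal_pow, re_ofReal_mul]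
    rw [hre, mul_left_comm]
    have hp : 0 < (t * (ε / 2)) ^ n := by
      have := ht.1
      positivity
    apply mul_pos hp
    interval_cases k
    · exact e3
    · exact e4
    · exact e5
    · exact e6

open Topology Filter

lemma harm_cont {u : ℂ → ℝ} {U : Set ℂ} (hu : HarmonicOnD u U) {z : ℂ} (hz : z ∈ U) :
    ContinuousAt u z := by
  obtain ⟨ε, hε, F, hF, h⟩ := hu z hz
  have hb : Metric.ball z ε ∈ 𝓝 z := Metric.ball_mem_nhds z hε
  have h1 : ContinuousAt (fun w => (F w).re) z :=
    continuous_re.continuousAt.comp (hF.differentiableAt hb).continuousAt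
  exact h1.congr (by filter_upwards [hb] with w hw using (h w hw).symm)

lemma harm_locmax {u : ℂ → ℝ} {U : Set ℂ} (hu : HarmonicOnD u U) {z : ℂ} (hz : z ∈ U)
    (hm : IsLocalMax u z) : ∀ᶠ y in 𝓝 z, u y = u z := by
  obtain ⟨ε, hε, F, hF, h⟩ := hu z hz
  have hb : Metric.ball z ε ∈ 𝓝 z := Metric.ball_mem_nhds z hε
  have hd : ∀ᶠ w in 𝓝 z, DifferentiableAt ℂ (fun w => exp (F w)) w := by
    filter_upwards [Metric.isOpen_ball.mem_nhds (Metric.mem_ball_self hε)] with w hw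
    exact (hF.differentiableAt (Metric.isOpen_ball.mem_nhds hw)).cexp
  have := eventually_eq_of_isLocalMax_norm hd (by
    filter_upwards [hm, hb] with w hw hwb
    simp only [Function.comp, norm_exp]
    rw [← h w hwb, ← h z (Metric.mem_ball_self hε)]
    exact Real.exp_le_exp.2 hw)
  filter_upwards [this, hb] with w hw hwb
  have h2 := congrArg norm hw
  rw [norm_exp, norm_exp, Real.exp_eq_exp] at h2
  rw [h w hwb, h z (Metric.mem_ball_self hε), h2]

lemma harm_neg {u : ℂ → ℝ} {U : Set ℂ} (hu : HarmonicOnD u U) :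
    HarmonicOnD (fun z => - u z) U := by
  intro z hz
  obtain ⟨ε, hε, F, hF, h⟩ := hu z hz
  exact ⟨ε, hε, fun w => - F w, hF.neg, fun w hw => by simp [h w hw]⟩

lemma harm_identity {u : ℂ → ℝ} {D : Set ℂ} (hDc : IsPreconnected D)
    (hu : HarmonicOnD u D) {z0 : ℂ} (hz0 : z0 ∈ D) {k : ℝ}
    (h : ∀ᶠ y in 𝓝 z0, u y = k) : ∀ z ∈ D, u z = k := by
  let A : Set ℂ := {z | ∀ᶠ y in 𝓝 z, u y = k}
  have hA : IsOpen A := isOpen_setOfPred_eventually_nhds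
  have hcl : closure A ∩ D ⊆ A := by
    rintro z ⟨hzA, hzD⟩
    obtain ⟨ε, hε, F, hF, hFu⟩ := hu z hzD
    obtain ⟨y, hyb, hyA⟩ := mem_closure_iff.1 hzA _ Metric.isOpen_ball (Metric.mem_ball_self hε)
    have hE : DifferentiableOn ℂ (fun w => exp (F w)) (Metric.ball z ε) := hF.cexp
    have hEa : AnalyticOnNhd ℂ (fun w => exp (F w)) (Metric.ball z ε) :=
      hE.analyticOnNhd Metric.isOpen_ball
    have hybn : Metric.ball z ε ∈ 𝓝 y := Metric.isOpen_ball.mem_nhds hyb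
    have hyk : u y = k := hyA.self_of_nhds
    have hloc := eventually_eq_of_isLocalMax_norm (f := fun w => exp (F w)) (c := y) (by
      filter_upwards [hybn] with w hw
      exact hE.differentiableAt (Metric.isOpen_ball.mem_nhds hw)) (by
      filter_upwards [hyA, hybn] with w hw hwb
      simp only [Function.comp, norm_exp]
      rw [← hFu w hwb, ← hFu y hyb, hw, hyk])
    have heq := hEa.eqOn_of_preconnected_of_eventuallyEq
      (g := fun _ => exp (F y)) analyticOnNhd_const
      (convex_ball z ε).isPreconnected hyb hloc
    filter_upwards [Metric.ball_mem_nhds z hε] with w hw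
    have h2 := congrArg norm (heq hw)
    simp only [norm_exp, Real.exp_eq_exp] at h2
    rw [hFu w hw, h2, ← hFu y hyb, hyk]
  have := hDc.subset_of_closure_inter_subset hA ⟨z0, hz0, h⟩ hcl
  intro z hz
  exact (this hz).self_of_nhds

lemma harm_max {u : ℂ → ℝ} {U C : Set ℂ} (hC : IsOpen C)
    (hb : Bornology.IsBounded C) (hCU : closure C ⊆ U) (hu : HarmonicOnD u U)
    {z : ℂ} (hz : z ∈ C) {M : ℝ} (hM : M < u z) : ∃ w ∈ frontier C, M < u w := by
  have hcomp : IsCompact (closure C) := hb.isCompact_closure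
  have hcont : ContinuousOn u (closure C) := fun w hw => (harm_cont hu (hCU hw)).continuousWithinAt
  obtain ⟨w0, hw0, hmax⟩ := hcomp.exists_isMaxOn ⟨z, subset_closure hz⟩ hcont
  have hMw : M < u w0 := hM.trans_le (hmax (subset_closure hz))
  by_contra hcon
  push Not at hcon
  let K : Set ℂ := {w ∈ closure C | u w = u w0}
  have hKC : K ⊆ C := by
    rintro w ⟨hw, hwe⟩
    by_contra hwC
    have : w ∈ frontier C := by
      rw [hC.frontier_eq]; exact ⟨hw, hwC⟩
    have := hcon w this
    linarith
  have hKc : IsClosed K := by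
    have := hcont.preimage_isClosed_of_isClosed isClosed_closure (isClosed_singleton (x := u w0))
    exact this
  have hKo : IsOpen K := by
    rw [isOpen_iff_mem_nhds]
    intro w hw
    have hwC := hKC hw
    have hCn := hC.mem_nhds hwC
    have hlm : IsLocalMax u w := by
      filter_upwards [hCn] with y hy
      rw [hw.2]; exact hmax (subset_closure hy)
    filter_upwards [hCn, harm_locmax hu (hCU hw.1) hlm] with y hy hyw
    exact ⟨subset_closure hy, hyw.trans hw.2⟩
  have huniv : K = univ := IsClopen.eq_univ ⟨hKc, hKo⟩ ⟨w0, hw0, rfl⟩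
  have : Bornology.IsBounded (univ : Set ℂ) := hb.subset (huniv ▸ hKC)
  exact NormedSpace.unbounded_univ ℝ ℂ this

lemma zero_closure {u : ℂ → ℝ} {U D : Set ℂ} (hDU : closure D ⊆ U) (hu : HarmonicOnD u U)
    (hid : ∀ z ∈ D, u z = 0) {w : ℂ} (hwc : w ∈ closure D) : u w = 0 := by
  have hcw := (harm_cont hu (hDU hwc)).continuousWithinAt (s := D)
  have := hcw.mem_closure (t := {0}) hwc (fun y hy => hid y hy)
  simpa using this

lemma harm_pos {u : ℂ → ℝ} {U D : Set ℂ} (hD : IsOpen D) (hDc : IsPreconnected D)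
    (hb : Bornology.IsBounded D) (hDU : closure D ⊆ U) (hu : HarmonicOnD u U)
    (hnn : ∀ w ∈ frontier D, 0 ≤ u w) (hp : ∃ w ∈ frontier D, u w ≠ 0) {z : ℂ} (hz : z ∈ D) :
    0 < u z := by
  have hge : ∀ y ∈ D, 0 ≤ u y := by
    intro y hy
    by_contra hc
    push Not at hc
    obtain ⟨w, hw, hw'⟩ := harm_max hD hb hDU (harm_neg hu) hy (M := 0) (by linarith)
    linarith [hnn w hw]
  by_contra hc
  have hz0 : u z = 0 := le_antisymm (not_lt.1 hc) (hge z hz)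
  have hlm : IsLocalMax (fun z => - u z) z := by
    filter_upwards [hD.mem_nhds hz] with y hy
    have := hge y hy
    linarith
  have hev := harm_locmax (harm_neg hu) (hDU (subset_closure hz)) hlm
  have hev' : ∀ᶠ y in 𝓝 z, u y = 0 := by
    filter_upwards [hev] with y hy
    linarith
  have hid := harm_identity hDc (fun y hy => hu y (hDU (subset_closure hy))) hz hev'
  obtain ⟨w, hw, hw0⟩ := hp
  apply hw0
  exact zero_closure hDU hu hid (frontier_subset_closure hw)

lemma annulus_preconn (c : ℂ) (a b : ℝ) (ha : 0 ≤ a) :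
    IsPreconnected {z : ℂ | ‖z - c‖ ∈ Ioo a b} := by
  have : {z : ℂ | ‖z - c‖ ∈ Ioo a b} =
      (fun x : ℝ × ℝ => c + x.1 * exp (x.2 * I)) '' (Ioo a b ×ˢ univ) := by
    ext z
    constructor
    · intro hz
      refine ⟨(‖z - c‖, arg (z - c)), ⟨hz, mem_univ _⟩, ?_⟩
      simp only
      rw [norm_mul_exp_arg_mul_I]; ring
    · rintro ⟨⟨x, y⟩, ⟨hx, -⟩, rfl⟩
      have hx : x ∈ Ioo a b := hx
      simp only [mem_ofPred_eq, add_sub_cancel_left, norm_mul, norm_exp_ofReal_mul_I, mul_one,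
        norm_real, Real.norm_eq_abs]
      rwa [abs_of_pos (ha.trans_lt hx.1)]
  rw [this]
  apply (isPreconnected_Ioo.prod isPreconnected_univ).image
  fun_prop

lemma subset_of_frontier {A D : Set ℂ} (hA : IsPreconnected A) (hD : IsOpen D)
    (hne : (A ∩ D).Nonempty) (hf : A ∩ frontier D = ∅) : A ⊆ D := by
  apply hA.subset_of_closure_inter_subset hD hne
  rintro z ⟨hz, hzA⟩
  by_contra hzD
  have : z ∈ A ∩ frontier D := ⟨hzA, by rw [hD.frontier_eq]; exact ⟨hz, hzD⟩⟩
  rw [hf] at this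
  exact this

lemma collar {D O : Set ℂ} {c : ℂ} {r : ℝ} (hr : 0 < r) (hD : IsOpen D) (hDc : IsPreconnected D)
    (hS : Metric.sphere c r ⊆ frontier D) (hO : IsOpen O) (hSO : Metric.sphere c r ⊆ O)
    (hOf : O ∩ frontier D ⊆ Metric.sphere c r) :
    ∃ A V : Set ℂ, IsPreconnected A ∧ A ⊆ D ∩ O ∧ IsOpen V ∧ Metric.sphere c r ⊆ V ∧
      V ∩ D ⊆ A := by
  obtain ⟨δ', hδ', hth'⟩ := (isCompact_sphere c r).exists_thickening_subset_open hO hSO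
  let δ := min δ' r
  have hδ : 0 < δ := lt_min hδ' hr
  have hδr : δ ≤ r := min_le_right _ _
  have hVO : ∀ z : ℂ, z ≠ c → |‖z - c‖ - r| < δ → z ∈ O := by
    intro z hzc hz
    have hn : 0 < ‖z - c‖ := norm_pos_iff.2 (sub_ne_zero.2 hzc)
    have hnC : (‖z - c‖ : ℂ) ≠ 0 := by exact_mod_cast hn.ne'
    apply hth'
    rw [Metric.mem_thickening_iff]
    refine ⟨c + (r / ‖z - c‖ : ℝ) * (z - c), ?_, ?_⟩
    · rw [mem_sphere_iff_norm, add_sub_cancel_left, norm_mul, norm_real, Real.norm_eq_abs,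
        abs_of_pos (by positivity)]
      field_simp
    · rw [dist_eq_norm]
      have : z - (c + (r / ‖z - c‖ : ℝ) * (z - c)) = ((1 - r / ‖z - c‖ : ℝ) : ℂ) * (z - c) := by
        push_cast; ring
      rw [this, norm_mul, norm_real, Real.norm_eq_abs]
      have e : |1 - r / ‖z - c‖| * ‖z - c‖ = |‖z - c‖ - r| := by
        rw [← abs_of_pos hn, ← abs_mul, abs_of_pos hn]
        congr 1
        field_simp
      rw [e]
      exact hz.trans_le (min_le_left _ _)
  let V : Set ℂ := {z | |‖z - c‖ - r| < δ}
  have hVo : IsOpen V := by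
    have : Continuous fun z : ℂ => |‖z - c‖ - r| := by fun_prop
    exact isOpen_lt this continuous_const
  have hSV : Metric.sphere c r ⊆ V := by
    intro z hz
    rw [mem_sphere_iff_norm] at hz
    simp [V, hz, hδ]
  have hDS : ∀ z ∈ D, ‖z - c‖ ≠ r := by
    intro z hz hzr
    have h1 : z ∈ frontier D := hS (mem_sphere_iff_norm.2 hzr)
    rw [hD.frontier_eq] at h1
    exact h1.2 hz
  have hVD : (V ∩ D).Nonempty := by
    have hp : c + r ∈ Metric.sphere c r := by
      rw [mem_sphere_iff_norm]; simp [abs_of_pos hr]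
    have := frontier_subset_closure (hS hp)
    exact mem_closure_iff.1 this V hVo (hSV hp)
  -- it suffices to find one-sided annulus
  have main : ∀ a b : ℝ, 0 ≤ a → r - δ ≤ a → b ≤ r + δ → r ∉ Ioo a b →
      V ∩ D ⊆ {z : ℂ | ‖z - c‖ ∈ Ioo a b} →
      ∃ A V : Set ℂ, IsPreconnected A ∧ A ⊆ D ∩ O ∧ IsOpen V ∧ Metric.sphere c r ⊆ V ∧
      V ∩ D ⊆ A := by
    intro a b ha h1 h2 h3 h4
    have hAO : {z : ℂ | ‖z - c‖ ∈ Ioo a b} ⊆ O := by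
      intro z hz
      have hz' : a < ‖z - c‖ ∧ ‖z - c‖ < b := hz
      apply hVO z
      · rintro rfl
        simp at hz'
        linarith [hz'.1]
      · rw [abs_lt]; constructor <;> linarith [hz'.1, hz'.2]
    refine ⟨_, V, annulus_preconn c a b ha, ?_, hVo, hSV, h4⟩
    refine subset_inter (subset_of_frontier (annulus_preconn c a b ha) hD ?_ ?_) hAO
    · obtain ⟨x, hx⟩ := hVD
      exact ⟨x, h4 hx, hx.2⟩
    · apply eq_empty_of_forall_notMem
      rintro z ⟨hz, hzf⟩
      have := hOf ⟨hAO hz, hzf⟩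
      rw [mem_sphere_iff_norm] at this
      apply h3
      rw [← this]; exact hz
  have hside : D ⊆ {z | ‖z - c‖ < r} ∨ D ⊆ {z | r < ‖z - c‖} := by
    have hc : Continuous fun z : ℂ => ‖z - c‖ := by fun_prop
    apply hDc.subset_or_subset (isOpen_lt hc continuous_const) (isOpen_lt continuous_const hc)
    · rw [Set.disjoint_left]
      intro z hz hz'
      exact lt_asymm (show ‖z - c‖ < r from hz) hz'
    · intro z hz
      exact lt_or_gt_of_ne (hDS z hz)
  rcases hside with h | h
  · refine main (r - δ) r (by linarith) le_rfl (by linarith) (by simp) ?_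
    rintro z ⟨hzV, hzD⟩
    have h1 : |‖z - c‖ - r| < δ := hzV
    rw [abs_lt] at h1
    exact ⟨by linarith [h1.1], h hzD⟩
  · refine main r (r + δ) hr.le (by linarith) le_rfl (by simp) ?_
    rintro z ⟨hzV, hzD⟩
    have h1 : |‖z - c‖ - r| < δ := hzV
    rw [abs_lt] at h1
    exact ⟨h hzD, by linarith [h1.2]⟩

lemma pos_preconn {u : ℂ → ℝ} {U D : Set ℂ} (hD : IsOpen D) (hDc : IsPreconnected D)
    (hb : Bornology.IsBounded D) (hU : IsOpen U) (hDU : closure D ⊆ U) (hu : HarmonicOnD u U)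
    {c : ℂ} {r : ℝ} (hr : 0 < r) (hS : Metric.sphere c r ⊆ frontier D)
    (hpos : ∀ z ∈ Metric.sphere c r, 0 < u z)
    (hle : ∀ z ∈ frontier D, z ∉ Metric.sphere c r → u z ≤ 0) :
    IsPreconnected {z ∈ D | 0 < u z} := by
  have hcontU : ContinuousOn u U := fun w hw => (harm_cont hu hw).continuousWithinAt
  set P : Set ℂ := {z ∈ D | 0 < u z} with hPdef
  have hPo : IsOpen P :=
    (hcontU.mono (subset_closure.trans hDU)).isOpen_inter_preimage hD isOpen_Ioi
  have hOo : IsOpen (U ∩ u ⁻¹' Ioi 0) := hcontU.isOpen_inter_preimage hU isOpen_Ioi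
  obtain ⟨A, V, hA, hADO, hV, hSV, hVD⟩ := collar (O := U ∩ u ⁻¹' Ioi 0) hr hD hDc hS hOo
    (fun z hz => ⟨hDU (frontier_subset_closure (hS hz)), hpos z hz⟩) (by
      rintro z ⟨hz, hzf⟩
      by_contra hc
      have h1 := hle z hzf hc
      have h2 : 0 < u z := hz.2
      linarith)
  have hAP : A ⊆ P := fun z hz => ⟨(hADO hz).1, (hADO hz).2.2⟩
  have key : ∀ x ∈ P, A.Nonempty ∧ A ⊆ connectedComponentIn P x := by
    intro x hx
    set C := connectedComponentIn P x with hC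
    have hCP : C ⊆ P := connectedComponentIn_subset P x
    have hCD : C ⊆ D := fun z hz => (hCP hz).1
    have hCo : IsOpen C := hPo.connectedComponentIn
    have hxC : x ∈ C := mem_connectedComponentIn hx
    have hCc : IsPreconnected C := isPreconnected_connectedComponentIn
    obtain ⟨w, hw, hw0⟩ := harm_max hCo (hb.subset hCD) ((closure_mono hCD).trans hDU) hu hxC
      (M := 0) hx.2
    have hwcl : w ∈ closure C := frontier_subset_closure hw
    have hwC : w ∉ C := by
      rw [hCo.frontier_eq] at hw; exact hw.2
    have hwD : w ∉ D := by
      intro hwD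
      have hins : IsPreconnected (insert w C) :=
        hCc.subset_closure (subset_insert w C) (insert_subset hwcl subset_closure)
      have := hins.subset_connectedComponentIn (mem_insert_of_mem w hxC)
        (insert_subset (show w ∈ P from ⟨hwD, hw0⟩) hCP)
      exact hwC (this (mem_insert w C))
    have hwf : w ∈ frontier D := by
      rw [hD.frontier_eq]; exact ⟨closure_mono hCD hwcl, hwD⟩
    have hwS : w ∈ Metric.sphere c r := by
      by_contra hc
      linarith [hle w hwf hc]
    obtain ⟨y, hyV, hyC⟩ := mem_closure_iff.1 hwcl V hV (hSV hwS)
    have hyA : y ∈ A := hVD ⟨hyV, hCD hyC⟩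
    refine ⟨⟨y, hyA⟩, ?_⟩
    have := hA.subset_connectedComponentIn hyA hAP
    rwa [← connectedComponentIn_eq hyC] at this
  rcases P.eq_empty_or_nonempty with h | ⟨x, hx⟩
  · rw [h]; exact isPreconnected_empty
  · apply isPreconnected_of_forall x
    intro y hy
    obtain ⟨⟨a, ha⟩, h1⟩ := key x hx
    obtain ⟨-, h2⟩ := key y hy
    refine ⟨connectedComponentIn P x, connectedComponentIn_subset P x,
      mem_connectedComponentIn hx, ?_, isPreconnected_connectedComponentIn⟩
    rw [connectedComponentIn_eq (h1 ha), ← connectedComponentIn_eq (h2 ha)]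
    exact mem_connectedComponentIn hy

lemma W_re {u : ℂ → ℝ} {F : ℂ → ℂ} {z : ℂ} (hF : DifferentiableAt ℂ F z)
    (h : ∀ᶠ w in 𝓝 z, u w = (F w).re) : Wfun u z = deriv F z ∧ DifferentiableAt ℝ u z := by
  have h1 : HasFDerivAt (fun w => (F w).re)
      (reCLM.comp ((ContinuousLinearMap.toSpanSingleton ℂ (deriv F z)).restrictScalars ℝ)) z :=
    reCLM.hasFDerivAt.comp z (hF.hasDerivAt.hasFDerivAt.restrictScalars ℝ)
  have h2 := h1.congr_of_eventuallyEq h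
  refine ⟨?_, h2.differentiableAt⟩
  rw [Wfun, h2.fderiv]
  apply Complex.ext <;> simp

lemma harm_add {u v : ℂ → ℝ} {U : Set ℂ} (hu : HarmonicOnD u U) (hv : HarmonicOnD v U) :
    HarmonicOnD (fun z => u z + v z) U := by
  intro z hz
  obtain ⟨ε, hε, F, hF, h⟩ := hu z hz
  obtain ⟨ε', hε', F', hF', h'⟩ := hv z hz
  have s1 : Metric.ball z (min ε ε') ⊆ Metric.ball z ε := Metric.ball_subset_ball (min_le_left _ _)
  have s2 : Metric.ball z (min ε ε') ⊆ Metric.ball z ε' := Metric.ball_subset_ball (min_le_right _ _)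
  exact ⟨min ε ε', lt_min hε hε', fun w => F w + F' w, (hF.mono s1).add (hF'.mono s2),
    fun w hw => by simp [h w (s1 hw), h' w (s2 hw)]⟩

lemma harm_smul {u : ℂ → ℝ} {U : Set ℂ} (k : ℝ) (hu : HarmonicOnD u U) :
    HarmonicOnD (fun z => k * u z) U := by
  intro z hz
  obtain ⟨ε, hε, F, hF, h⟩ := hu z hz
  exact ⟨ε, hε, fun w => (k : ℂ) * F w, hF.const_mul _, fun w hw => by simp [h w hw]⟩

lemma harm_const (k : ℝ) (U : Set ℂ) : HarmonicOnD (fun _ => k) U := by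
  intro z hz
  exact ⟨1, one_pos, fun _ => (k : ℂ), differentiableOn_const _, fun w hw => by simp⟩

lemma harm_sum {ι : Type*} (s : Finset ι) {u : ι → ℂ → ℝ} {U : Set ℂ}
    (hu : ∀ i, HarmonicOnD (u i) U) : HarmonicOnD (fun z => ∑ i ∈ s, u i z) U := by
  classical
  induction s using Finset.induction_on with
  | empty => simpa using harm_const 0 U
  | insert a s ha ih =>
    simp only [Finset.sum_insert ha]
    exact harm_add (hu a) ih

lemma harm_W_zero {u : ℂ → ℝ} {U : Set ℂ} (hu : HarmonicOnD u U) {z : ℂ} (hz : z ∈ U)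
    (hW : Wfun u z = 0) : HasFDerivAt u (0 : ℂ →L[ℝ] ℝ) z := by
  obtain ⟨ε, hε, F, hF, h⟩ := hu z hz
  have hb : Metric.ball z ε ∈ 𝓝 z := Metric.ball_mem_nhds z hε
  have hd : DifferentiableAt ℝ u z :=
    (W_re (hF.differentiableAt hb) (by filter_upwards [hb] with w hw using h w hw)).2
  have h0 : fderiv ℝ u z = 0 := by
    have h1 := congrArg re hW
    have h2 := congrArg im hW
    simp [Wfun] at h1 h2
    ext w
    have : w = w.re • (1:ℂ) + w.im • I := by simp
    rw [this, map_add, map_smul, map_smul, h1, h2]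
    simp
  have := hd.hasFDerivAt
  rwa [h0] at this

theorem stmt_7 (m : ℕ) (hm : 2 ≤ m) (D : Set ℂ) (hDo : IsOpen D) (hDc : IsConnected D)
    (hDb : Bornology.IsBounded D)
    (c : Fin m → ℂ) (r : Fin m → ℝ) (hr : ∀ j, 0 < r j)
    (hdisj : Pairwise (Function.onFun Disjoint fun j => Metric.sphere (c j) (r j)))
    (hfront : frontier D = ⋃ j, Metric.sphere (c j) (r j))
    (jout : Fin m) (hout : closure D ⊆ Metric.closedBall (c jout) (r jout))
    (h : Fin m → ℂ → ℝ)
    (hharm : ∀ j, ∃ U : Set ℂ, IsOpen U ∧ closure D ⊆ U ∧ HarmonicOnD (h j) U)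
    (hbv : ∀ j k, ∀ z ∈ Metric.sphere (c k) (r k), h j z = if k = j then 1 else 0) :
    ∀ z ∈ D, ∃ j, j ≠ jout ∧ Wfun (h j) z ≠ 0 := by
  classical
  intro z0 hz0
  by_contra hcon
  push Not at hcon
  choose Uj hUjo hUjD hUjh using hharm
  let U : Set ℂ := ⋂ j, Uj j
  have hUo : IsOpen U := isOpen_iInter_of_finite hUjo
  have hDU : closure D ⊆ U := subset_iInter hUjD
  have hh : ∀ j, HarmonicOnD (h j) U := fun j z hz => hUjh j z (mem_iInter.1 hz j)
  have hz0U : z0 ∈ U := hDU (subset_closure hz0)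
  have hDp : IsPreconnected D := hDc.isPreconnected
  have : Nontrivial (Fin m) := Fin.nontrivial_iff_two_le.2 hm
  obtain ⟨a, ha⟩ := exists_ne jout
  have hsf : ∀ k, Metric.sphere (c k) (r k) ⊆ frontier D := by
    intro k; rw [hfront]; exact subset_iUnion (fun j => Metric.sphere (c j) (r j)) k
  have hpt : ∀ k, c k + r k ∈ Metric.sphere (c k) (r k) := by
    intro k; rw [mem_sphere_iff_norm]; simp [abs_of_pos (hr k)]
  have hfr : ∀ z ∈ frontier D, ∃ k, z ∈ Metric.sphere (c k) (r k) := by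
    intro z hz; rw [hfront] at hz; exact mem_iUnion.1 hz
  -- the harmonic measure of the outer circle, rebuilt from the others
  let H : ℂ → ℝ := fun z => 1 + (-1) * ∑ j ∈ Finset.univ.erase jout, h j z
  have hH : HarmonicOnD H U := harm_add (harm_const 1 U) (harm_smul (-1) (harm_sum _ hh))
  have hHb : ∀ k, ∀ z ∈ Metric.sphere (c k) (r k), H z = if k = jout then 1 else 0 := by
    intro k z hz
    simp only [H]
    rw [Finset.sum_congr rfl (fun j _ => hbv j k z hz), Finset.sum_ite_eq]
    by_cases hk : k = jout <;> simp [hk]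
  have posgen : ∀ (v : ℂ → ℝ) (b : Fin m), HarmonicOnD v U →
      (∀ k, ∀ z ∈ Metric.sphere (c k) (r k), v z = if k = b then 1 else 0) → 0 < v z0 := by
    intro v b hv hvb
    refine harm_pos hDo hDp hDb hDU hv ?_ ⟨c b + r b, hsf b (hpt b), ?_⟩ hz0
    · intro w hw
      obtain ⟨k, hk⟩ := hfr w hw
      rw [hvb k w hk]; split_ifs <;> norm_num
    · rw [hvb b _ (hpt b)]; simp
  have hapos : 0 < h a z0 := posgen _ a (hh a) (hbv a)
  have hHpos : 0 < H z0 := posgen _ jout hH hHb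
  let l : ℝ := h a z0 / H z0
  have hl : 0 < l := div_pos hapos hHpos
  let u : ℂ → ℝ := fun z => h a z + (-l) * H z
  have hu : HarmonicOnD u U := harm_add (hh a) (harm_smul (-l) hH)
  have hu0 : u z0 = 0 := by simp only [u, l]; field_simp; ring
  have hub : ∀ k, ∀ z ∈ Metric.sphere (c k) (r k),
      u z = (if k = a then 1 else 0) + (-l) * (if k = jout then 1 else 0) := by
    intro k z hz; simp only [u]; rw [hbv a k z hz, hHb k z hz]
  have hud : HasFDerivAt u (0 : ℂ →L[ℝ] ℝ) z0 := by
    have hj : ∀ j ∈ Finset.univ.erase jout, HasFDerivAt (h j) (0 : ℂ →L[ℝ] ℝ) z0 := by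
      intro j hj
      exact harm_W_zero (hh j) hz0U (hcon j (Finset.ne_of_mem_erase hj))
    have hs := HasFDerivAt.fun_sum hj
    have h1 := ((hs.const_mul (-1)).const_add 1).const_mul (-l)
    have h2 := (hj a (by simp [ha])).fun_add h1
    refine h2.congr_fderiv ?_
    simp
  -- the two nodal domains
  let P : Set ℂ := {z ∈ D | 0 < u z}
  let N : Set ℂ := {z ∈ D | 0 < - u z}
  have hPp : IsPreconnected P := by
    refine pos_preconn hDo hDp hDb hUo hDU hu (hr a) (hsf a) ?_ ?_
    · intro z hz; rw [hub a z hz]; simp [ha]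
    · intro z hz hza
      obtain ⟨k, hk⟩ := hfr z hz
      have hka : k ≠ a := by rintro rfl; exact hza hk
      rw [hub k z hk, if_neg hka]
      split_ifs <;> linarith
  have hNp : IsPreconnected N := by
    refine pos_preconn hDo hDp hDb hUo hDU (harm_neg hu) (hr jout) (hsf jout) ?_ ?_
    · intro z hz; rw [hub jout z hz]; simp [ha.symm, hl]
    · intro z hz hza
      obtain ⟨k, hk⟩ := hfr z hz
      have hka : k ≠ jout := by rintro rfl; exact hza hk
      rw [hub k z hk, if_neg hka]
      split_ifs <;> norm_num
  have hcontD : ContinuousOn u D :=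
    fun w hw => (harm_cont hu (hDU (subset_closure hw))).continuousWithinAt
  have hPo : IsOpen P := hcontD.isOpen_inter_preimage hDo isOpen_Ioi
  have hNo : IsOpen N := hcontD.neg.isOpen_inter_preimage hDo isOpen_Ioi
  -- local structure
  obtain ⟨ε, hε, F, hF, hFu⟩ := hu z0 hz0U
  have hball : Metric.ball z0 ε ∈ 𝓝 z0 := Metric.ball_mem_nhds z0 hε
  have hFa : AnalyticAt ℂ F z0 := hF.analyticAt hball
  have hFue : ∀ᶠ w in 𝓝 z0, u w = (F w).re := by filter_upwards [hball] with w hw using hFu w hw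
  have hF0 : (F z0).re = 0 := by rw [← hFu z0 (Metric.mem_ball_self hε), hu0]
  have hdF : deriv F z0 = 0 := by
    rw [← (W_re hFa.differentiableAt hFue).1, Wfun, hud.fderiv]; simp
  have hnc : ¬ ∀ᶠ z in 𝓝 z0, F z = F z0 := by
    intro hc
    have hev : ∀ᶠ y in 𝓝 z0, u y = 0 := by
      filter_upwards [hc, hFue] with y h1 h2
      rw [h2, h1, hF0]
    have hid := harm_identity hDp (fun y hy => hu y (hDU (subset_closure hy))) hz0 hev
    have h1 := zero_closure hDU hu hid (frontier_subset_closure (hsf a (hpt a)))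
    rw [hub a _ (hpt a)] at h1
    simp [ha] at h1
  obtain ⟨ω, δ, hω, hδ, hδ', hsec⟩ := local_sectors hFa hF0 hdF hnc (D ∩ Metric.ball z0 ε)
    (Filter.inter_mem (hDo.mem_nhds hz0) hball)
  have hsec' : ∀ k : ℕ, k < 4 → ∀ t ∈ Ioc (0:ℝ) 1,
      z0 + t * (ω * exp (δ * I) ^ k) ∈ D ∧
        0 < (-1) ^ k * u (z0 + t * (ω * exp (δ * I) ^ k)) := by
    intro k hk t ht
    obtain ⟨h1, h2⟩ := hsec k hk t ht
    exact ⟨h1.1, by rw [hFu _ h1.2]; exact h2⟩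
  have tr : ∀ (S : Set ℂ) (w : ℂ), z0 + w ∈ S → w ∈ (fun z => z - z0) '' S :=
    fun S w hw => ⟨z0 + w, hw, by simp⟩
  have g0 : ∀ t ∈ Ioc (0:ℝ) 1, (z0 + t * ω : ℂ) ∈ P := by
    intro t ht
    have := hsec' 0 (by norm_num) t ht
    simp only [pow_zero, mul_one, one_mul] at this
    exact this
  have g1 : ∀ t ∈ Ioc (0:ℝ) 1, (z0 + t * (ω * exp (δ * I)) : ℂ) ∈ N := by
    intro t ht
    have := hsec' 1 (by norm_num) t ht
    simp only [pow_one, neg_mul, one_mul] at this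
    exact this
  have g2 : ∀ t ∈ Ioc (0:ℝ) 1, (z0 + t * (ω * exp (δ * I) ^ 2) : ℂ) ∈ P := by
    intro t ht
    have := hsec' 2 (by norm_num) t ht
    rw [show ((-1:ℝ)) ^ 2 = 1 by norm_num, one_mul] at this
    exact this
  have g3 : ∀ t ∈ Ioc (0:ℝ) 1, (z0 + t * (ω * exp (δ * I) ^ 3) : ℂ) ∈ N := by
    intro t ht
    have := hsec' 3 (by norm_num) t ht
    rw [show ((-1:ℝ)) ^ 3 = -1 by norm_num, neg_one_mul] at this
    exact this
  have o1 : (1:ℝ) ∈ Ioc (0:ℝ) 1 := ⟨one_pos, le_rfl⟩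
  have hPpc : IsPathConnected P := hPo.isConnected_iff_isPathConnected.1 ⟨⟨_, g0 1 o1⟩, hPp⟩
  have hNpc : IsPathConnected N := hNo.isConnected_iff_isPathConnected.1 ⟨⟨_, g1 1 o1⟩, hNp⟩
  have hsub : Continuous fun z : ℂ => z - z0 := by fun_prop
  refine no_cross (hPpc.image hsub) (hNpc.image hsub) ?_ ?_ ?_ ω hω δ hδ hδ'
    (fun t ht => tr _ _ (g0 t ht)) (fun t ht => tr _ _ (g1 t ht))
    (fun t ht => tr _ _ (g2 t ht)) (fun t ht => tr _ _ (g3 t ht))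
  · rw [Set.disjoint_left]
    rintro w ⟨x, hx, rfl⟩ ⟨y, hy, hxy⟩
    have : y = x := by simpa using hxy
    subst this
    have h1 : 0 < u y := hx.2
    have h2 : 0 < - u y := hy.2
    linarith
  · rintro ⟨x, hx, hx0⟩
    have : x = z0 := sub_eq_zero.1 hx0
    subst this
    have h1 : 0 < u x := hx.2
    linarith
  · rintro ⟨x, hx, hx0⟩
    have : x = z0 := sub_eq_zero.1 hx0
    subst this
    have h1 : 0 < - u x := hx.2
    linarith
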